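/- Let C be a minimum weight cycle in a finite simple undirected graph G with positive real edge weights, let x and y be two distinct vertices lying on C, and let π¹ and π² be the two arcs of C from x to y, with w(π¹) ≤ w(π²). Then π¹ is a shortest path from x to y in G (that is, w(π¹) = d_G(x, y)), and π² is a second simple shortest path from x to y: every simple path from x to y in G that is not identical to π¹ has weight at least w(π²). -/

import Mathlib

namespace Stmt1

/-- The weight of a walk: the sum of the weights of its edges. -/
def walkWt {V : Type*} {G : SimpleGraph V} (w : Sym2 V → ℝ) {x y : V} (p : G.Walk x y) : ℝ :=
  (p.edges.map w).sum

lemma walkWt_append {V : Type*} {G : SimpleGraph V} (w : Sym2 V → ℝ) {x y z : V}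
    (p : G.Walk x y) (q : G.Walk y z) : walkWt w (p.append q) = walkWt w p + walkWt w q := by
  simp [walkWt]

lemma walkWt_reverse {V : Type*} {G : SimpleGraph V} (w : Sym2 V → ℝ) {x y : V}
    (p : G.Walk x y) : walkWt w p.reverse = walkWt w p := by
  simp [walkWt]

/-- Two distinct paths with the same ends span a cycle, whose weight is at most the sum of
their weights. -/
lemma exists_isCycle_walkWt_le {V : Type*} {G : SimpleGraph V} (w : Sym2 V → ℝ)
    (hw : ∀ e ∈ G.edgeSet, 0 ≤ w e) {x y : V} {p q : G.Walk x y} (hp : p.IsPath)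
    (hq : q.IsPath) (hne : p ≠ q) :
    ∃ (u : V) (D : G.Walk u u), D.IsCycle ∧ walkWt w D ≤ walkWt w p + walkWt w q := by
  let H := SimpleGraph.fromEdgeSet {e | e ∈ p.edges ++ q.edges}
  have hE {e : Sym2 V} (he : e ∈ p.edges ++ q.edges) : e ∈ G.edgeSet := by
    rcases List.mem_append.1 he with h | h
    exacts [p.edges_subset_edgeSet h, q.edges_subset_edgeSet h]
  have hH {e : Sym2 V} (he : e ∈ p.edges ++ q.edges) : e ∈ H.edgeSet := by
    rw [SimpleGraph.edgeSet_fromEdgeSet]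
    exact ⟨he, G.not_isDiag_of_mem_edgeSet (hE he)⟩
  have hpH : ∀ e ∈ p.edges, e ∈ H.edgeSet := fun e he => hH (List.mem_append_left _ he)
  have hqH : ∀ e ∈ q.edges, e ∈ H.edgeSet := fun e he => hH (List.mem_append_right _ he)
  have hHmem {e : Sym2 V} (he : e ∈ H.edgeSet) : e ∈ p.edges ++ q.edges := by
    rw [SimpleGraph.edgeSet_fromEdgeSet] at he
    exact he.1
  have hcyc : ¬ H.IsAcyclic := by
    intro hac
    have h := (hac.subsingleton_path x y).elim ⟨_, hp.transfer hpH⟩ ⟨_, hq.transfer hqH⟩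
    have h' : (p.transfer H hpH).support = (q.transfer H hqH).support :=
      congrArg (fun r : H.Path x y => r.1.support) h
    rw [SimpleGraph.Walk.support_transfer, SimpleGraph.Walk.support_transfer] at h'
    exact hne (SimpleGraph.Walk.ext_support h')
  obtain ⟨u, D, hD⟩ : ∃ (u : V) (D : H.Walk u u), D.IsCycle := by
    simpa [SimpleGraph.IsAcyclic] using hcyc
  have hDE : ∀ e ∈ D.edges, e ∈ p.edges ++ q.edges := fun e he =>
    hHmem (D.edges_subset_edgeSet he)
  refine ⟨u, D.transfer G fun e he => hE (hDE e he), hD.transfer _, ?_⟩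
  obtain ⟨l, hl, hls⟩ := List.subperm_of_subset hD.edges_nodup hDE
  have hsum := (hls.map w).sum_le_sum (by
    simp only [List.mem_map]
    rintro _ ⟨e, he, rfl⟩
    exact hw e (hE he))
  rw [(hl.map w).sum_eq] at hsum
  simpa [walkWt] using hsum

/-- Let `C = π₁.append π₂` be a minimum weight cycle of `G` (positive real edge
weights), through the two distinct vertices `x` and `y`; the two arcs of `C` from `x` to `y`
are `π₁` and `π₂.reverse`, and assume `w(π₁) ≤ w(π₂.reverse)`.  Then `π₁` is a shortest
path from `x` to `y` in `G`, and `π₂.reverse` is a second simple shortest path: every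
simple path from `x` to `y` other than `π₁` has weight at least `w(π₂.reverse)`. -/
theorem stmt1 {V : Type*} [Fintype V] (G : SimpleGraph V) (w : Sym2 V → ℝ)
    (hw : ∀ e ∈ G.edgeSet, 0 < w e)
    (x y : V) (hxy : x ≠ y)
    (π₁ : G.Walk x y) (π₂ : G.Walk y x)
    (hC : (π₁.append π₂).IsCycle)
    (hmin : ∀ (u : V) (D : G.Walk u u), D.IsCycle → walkWt w (π₁.append π₂) ≤ walkWt w D)
    (hle : walkWt w π₁ ≤ walkWt w π₂.reverse) :
    (∀ q : G.Walk x y, q.IsPath → walkWt w π₁ ≤ walkWt w q) ∧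
      (∀ q : G.Walk x y, q.IsPath → q ≠ π₁ → walkWt w π₂.reverse ≤ walkWt w q) := by
  have hπ₁ : π₁.IsPath :=
    hC.isPath_of_append_left (SimpleGraph.Walk.not_nil_of_ne hxy.symm)
  have hsecond : ∀ q : G.Walk x y, q.IsPath → q ≠ π₁ → walkWt w π₂.reverse ≤ walkWt w q := by
    intro q hq hne
    obtain ⟨u, D, hD, hDw⟩ :=
      exists_isCycle_walkWt_le w (fun e he => (hw e he).le) hπ₁ hq hne.symm
    have h := hmin u D hD
    rw [walkWt_append] at h
    rw [walkWt_reverse]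
    linarith
  refine ⟨fun q hq => ?_, hsecond⟩
  by_cases h : q = π₁
  · rw [h]
  · exact hle.trans (hsecond q hq h)

end Stmt1
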